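/- Let F and B be matrices (over ℝ or ℂ) of sizes p×n₁ and p×n₂ respectively, and suppose F·Fᴴ + B·Bᴴ is invertible. Then every eigenvalue x of the matrix H = (F·Fᴴ − B·Bᴴ)·(F·Fᴴ + B·Bᴴ)⁻¹ satisfies −1 ≤ x ≤ 1. -/

import Mathlib

open scoped ComplexOrder in
/-- The eigenvalues of `(P - Q) * (P + Q)⁻¹` are real and lie in `[-1, 1]` for positive
semidefinite `P` and `Q` with invertible sum; realness is contained in the order on `𝕜`. -/
theorem Matrix.PosSemidef.hasEigenvalue_sub_mul_inv_add_mem_Icc {𝕜 n : Type*} [RCLike 𝕜]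
    [Fintype n] [DecidableEq n] {P Q : Matrix n n 𝕜} (hP : P.PosSemidef) (hQ : Q.PosSemidef)
    (hPQ : IsUnit (P + Q)) {μ : 𝕜}
    (hμ : Module.End.HasEigenvalue (Matrix.toLin' ((P - Q) * (P + Q)⁻¹)) μ) :
    μ ∈ Set.Icc (-1) 1 := by
  obtain ⟨v, hv⟩ := hμ.exists_hasEigenvector
  have hdet : IsUnit (P + Q).det := (Matrix.isUnit_iff_isUnit_det _).mp hPQ
  obtain ⟨w, rfl⟩ : ∃ w, (P + Q).mulVec w = v :=
    ⟨(P + Q)⁻¹.mulVec v, by rw [Matrix.mulVec_mulVec, Matrix.mul_nonsing_inv _ hdet,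
      Matrix.one_mulVec]⟩
  have hw : w ≠ 0 := by
    rintro rfl
    exact hv.2 (Matrix.mulVec_zero _)
  have heq : (P - Q).mulVec w = μ • (P + Q).mulVec w := by
    have h := hv.apply_eq_smul
    rwa [Matrix.toLin'_apply, Matrix.mulVec_mulVec, Matrix.mul_assoc,
      Matrix.nonsing_inv_mul _ hdet, Matrix.mul_one] at h
  have hpos := (((hP.add hQ).posDef_iff_isUnit).mpr hPQ).dotProduct_mulVec_pos hw
  have ha := hP.dotProduct_mulVec_nonneg w
  have hb := hQ.dotProduct_mulVec_nonneg w
  have h := congrArg (star w ⬝ᵥ ·) heq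
  simp only [Matrix.sub_mulVec, Matrix.add_mulVec, dotProduct_sub, dotProduct_add,
    dotProduct_smul, smul_eq_mul] at h hpos
  constructor
  · refine le_of_mul_le_mul_right (sub_nonneg.mp ?_) hpos
    rw [← h]
    convert add_nonneg ha ha using 1
    ring
  · refine le_of_mul_le_mul_right (sub_nonneg.mp ?_) hpos
    rw [← h]
    convert add_nonneg hb hb using 1
    ring


/-- Every eigenvalue `x` of `H = (F·Fᴴ − B·Bᴴ)·(F·Fᴴ + B·Bᴴ)⁻¹`
(with `F·Fᴴ + B·Bᴴ` invertible) satisfies `-1 ≤ x ≤ 1`. -/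
theorem jacobi_eigenvalue_in_interval
    (p n₁ n₂ : ℕ) (F : Matrix (Fin p) (Fin n₁) ℂ) (B : Matrix (Fin p) (Fin n₂) ℂ)
    (hinv : IsUnit (F * F.conjTranspose + B * B.conjTranspose))
    (x : ℝ)
    (hx : Module.End.HasEigenvalue
      (Matrix.toLin'
        ((F * F.conjTranspose - B * B.conjTranspose) *
          (F * F.conjTranspose + B * B.conjTranspose)⁻¹)) (x : ℂ)) :
    -1 ≤ x ∧ x ≤ 1 := by
  open scoped ComplexOrder in
  have h := (Matrix.posSemidef_self_mul_conjTranspose F).hasEigenvalue_sub_mul_inv_add_mem_Icc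
    (Matrix.posSemidef_self_mul_conjTranspose B) hinv hx
  open scoped ComplexOrder in
  exact ⟨by simpa using (Complex.le_def.mp h.1).1, by simpa using (Complex.le_def.mp h.2).1⟩
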